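/- arXiv:2105.10229 — 2 statements merged into one kernel-verified Lean document; each statement's English description precedes it below -/
import Mathlib

section
/- Recovery of the diameter from local stopping times (Theorem 3, D = max k_i − 2 form): for each vertex i let τ(i) be the least k ∈ ℕ with X (k+1) i = X k i (the number of informative iterations at node i). Then the finite digraph diameter D equals the maximum of τ(i) over all vertices i, which also equals the maximum in-eccentricity max_i e(i). -/
open scoped Classical

variable {V : Type*}

/-- Walks of length exactly `n`: `stepRel Adj n u v` means there is a directed walk
from `u` to `v` of length `n`. -/
def stepRel (Adj : V → V → Prop) : ℕ → V → V → Prop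
  | 0 => Eq
  | (n+1) => fun u v => ∃ w, Adj u w ∧ stepRel Adj n w v

/-- `ddist Adj u v` is the minimum length of a directed walk from `u` to `v`
(meaningful when `u` reaches `v`). -/
noncomputable def ddist (Adj : V → V → Prop) (u v : V) : ℕ :=
  sInf {n | stepRel Adj n u v}

/-- `reachSet Adj v` is the finite set of vertices that reach `v`. -/
noncomputable def reachSet [Fintype V] (Adj : V → V → Prop) (v : V) : Finset V :=
  Finset.univ.filter (fun u => Relation.ReflTransGen Adj u v)

/-- In-eccentricity: the maximum of `ddist Adj j i` over all `j` reaching `i`. -/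
noncomputable def ecc [Fintype V] (Adj : V → V → Prop) (i : V) : ℕ :=
  (Finset.univ.filter (fun j => Relation.ReflTransGen Adj j i)).sup
    (fun j => ddist Adj j i)

/-- Finite digraph diameter: maximum of `ddist Adj u v` over ordered pairs `(u, v)`
with `u` reaching `v`. -/
noncomputable def fdiam [Fintype V] (Adj : V → V → Prop) : ℕ :=
  (Finset.univ.filter (fun p : V × V => Relation.ReflTransGen Adj p.1 p.2)).sup
    (fun p => ddist Adj p.1 p.2)

/-- Algorithm 1's flooding iteration: `flood Adj 0 i = {i}` and
`flood Adj (k+1) i = flood Adj k i ∪ ⋃_{j with Adj j i} flood Adj k j`. -/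
noncomputable def flood [Fintype V] [DecidableEq V] (Adj : V → V → Prop) : ℕ → V → Finset V
  | 0, i => {i}
  | (k+1), i => flood Adj k i ∪
      (Finset.univ.filter (fun j => Adj j i)).biUnion (fun j => flood Adj k j)

theorem stepRel_succ_iff (Adj : V → V → Prop) (n : ℕ) (u v : V) :
    stepRel Adj (n + 1) u v ↔ ∃ w, stepRel Adj n u w ∧ Adj w v := by
  induction n generalizing u with
  | zero => simp [stepRel]
  | succ n ih =>
    rw [stepRel]
    simp only [ih]
    constructor
    · rintro ⟨w, huw, x, hwx, hxv⟩
      exact ⟨x, ⟨w, huw, hwx⟩, hxv⟩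
    · rintro ⟨x, ⟨w, huw, hwx⟩, hxv⟩
      exact ⟨w, huw, x, hwx, hxv⟩

theorem reflTransGen_iff_exists_stepRel (Adj : V → V → Prop) (u v : V) :
    Relation.ReflTransGen Adj u v ↔ ∃ n, stepRel Adj n u v := by
  constructor
  · intro h
    induction h with
    | refl => exact ⟨0, rfl⟩
    | tail _ hbc ih =>
      obtain ⟨n, hn⟩ := ih
      exact ⟨n + 1, (stepRel_succ_iff Adj n _ _).2 ⟨_, hn, hbc⟩⟩
  · rintro ⟨n, hn⟩
    induction n generalizing u with
    | zero => exact hn ▸ .refl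
    | succ n ih =>
      obtain ⟨w, huw, hwv⟩ := hn
      exact .head huw (ih w hwv)

theorem mem_flood_iff_exists_stepRel [Fintype V] [DecidableEq V] (Adj : V → V → Prop)
    (k : ℕ) (i j : V) : j ∈ flood Adj k i ↔ ∃ n ≤ k, stepRel Adj n j i := by
  induction k generalizing i with
  | zero => simp [flood, stepRel]
  | succ k ih =>
    simp only [flood, Finset.mem_union, Finset.mem_biUnion, Finset.mem_filter,
      Finset.mem_univ, true_and, ih]
    constructor
    · rintro (⟨n, hn, h⟩ | ⟨w, hwi, n, hn, h⟩)
      · exact ⟨n, by omega, h⟩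
      · exact ⟨n + 1, by omega, (stepRel_succ_iff Adj n j i).2 ⟨w, h, hwi⟩⟩
    · rintro ⟨_ | n, hn, h⟩
      · exact .inl ⟨0, k.zero_le, h⟩
      · obtain ⟨w, hjw, hwi⟩ := (stepRel_succ_iff Adj n j i).1 h
        exact .inr ⟨w, hwi, n, by omega, hjw⟩

theorem mem_flood_iff_ddist_le [Fintype V] [DecidableEq V] (Adj : V → V → Prop)
    {k : ℕ} {i j : V} (h : Relation.ReflTransGen Adj j i) :
    j ∈ flood Adj k i ↔ ddist Adj j i ≤ k := by
  rw [mem_flood_iff_exists_stepRel]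
  constructor
  · rintro ⟨n, hn, hs⟩
    exact (Nat.sInf_le (s := {n | stepRel Adj n j i}) hs).trans hn
  · exact fun hk => ⟨_, hk, Nat.sInf_mem ((reflTransGen_iff_exists_stepRel Adj j i).1 h)⟩

theorem mem_flood_ecc_add [Fintype V] [DecidableEq V] (Adj : V → V → Prop) (m : ℕ) (i j : V) :
    j ∈ flood Adj (ecc Adj i + m) i ↔ Relation.ReflTransGen Adj j i := by
  constructor
  · rw [mem_flood_iff_exists_stepRel, reflTransGen_iff_exists_stepRel]
    rintro ⟨n, -, hn⟩
    exact ⟨n, hn⟩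
  · intro h
    rw [mem_flood_iff_ddist_le Adj h]
    exact (Finset.le_sup (f := fun j => ddist Adj j i) (by simpa using h)).trans
      (Nat.le_add_right _ m)

theorem mem_flood_of_flood_succ_eq [Fintype V] [DecidableEq V] (Adj : V → V → Prop)
    {k : ℕ} {i : V} (hk : flood Adj (k + 1) i = flood Adj k i) {j : V}
    (h : Relation.ReflTransGen Adj j i) : j ∈ flood Adj k i := by
  induction h using Relation.ReflTransGen.head_induction_on with
  | refl => exact (mem_flood_iff_exists_stepRel Adj k i i).2 ⟨0, k.zero_le, rfl⟩
  | head hjw _ ih =>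
    obtain ⟨n, hn, hs⟩ := (mem_flood_iff_exists_stepRel Adj k i _).1 ih
    rw [← hk, mem_flood_iff_exists_stepRel]
    exact ⟨n + 1, by omega, _, hjw, hs⟩

/-- The local stopping time of the flooding iteration at `i` is the in-eccentricity of `i`. -/
theorem isLeast_flood_succ_eq_ecc [Fintype V] [DecidableEq V] (Adj : V → V → Prop) (i : V) :
    IsLeast {k : ℕ | flood Adj (k + 1) i = flood Adj k i} (ecc Adj i) := by
  refine ⟨?_, fun k hk => Finset.sup_le fun j hj => ?_⟩
  · ext j
    exact (mem_flood_ecc_add Adj 1 i j).trans (mem_flood_ecc_add Adj 0 i j).symm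
  · have h : Relation.ReflTransGen Adj j i := by simpa using hj
    exact (mem_flood_iff_ddist_le Adj h).1 (mem_flood_of_flood_succ_eq Adj hk h)

theorem fdiam_eq_sup_ecc [Fintype V] (Adj : V → V → Prop) :
    fdiam Adj = Finset.univ.sup (fun i : V => ecc Adj i) := by
  apply eq_of_forall_ge_iff
  intro c
  simp only [fdiam, ecc, Finset.sup_le_iff, Finset.mem_filter, Finset.mem_univ, true_and,
    Prod.forall, true_imp_iff]
  exact forall_comm

/-- Theorem 3, `D = max kᵢ − 2` form: with `τ(i)` the least `k`
such that `X (k+1) i = X k i`, the finite digraph diameter equals `max_i τ(i)`,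
which also equals the maximum in-eccentricity `max_i e(i)`. -/
theorem stmt13 [Fintype V] [DecidableEq V] (Adj : V → V → Prop) :
    fdiam Adj =
      Finset.univ.sup (fun i : V => sInf {k : ℕ | flood Adj (k+1) i = flood Adj k i}) ∧
    fdiam Adj = Finset.univ.sup (fun i : V => ecc Adj i) := by
  refine ⟨?_, fdiam_eq_sup_ecc Adj⟩
  rw [fdiam_eq_sup_ecc]
  exact Finset.sup_congr rfl fun i _ => (isLeast_flood_succ_eq_ecc Adj i).csInf_eq.symm
end

section
/- End-to-end correctness of Algorithm 1's output: for every k ≥ D (the finite digraph diameter) and every vertex i, the set z_i := {j ∈ X k i : |X k j| = |X k i|} computed from the flooding iterates equals the strongly connected component of i, i.e. z_i = {j : j reaches i and i reaches j}. -/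
open scoped Classical

variable {V : Type*}

theorem stepRel_succ_right (Adj : V → V → Prop) {n : ℕ} {u v : V}
    (h : stepRel Adj (n + 1) u v) : ∃ w, stepRel Adj n u w ∧ Adj w v := by
  induction n generalizing u with
  | zero =>
    obtain ⟨w, huw, rfl⟩ := h
    exact ⟨u, rfl, huw⟩
  | succ n ih =>
    obtain ⟨x, hux, hxv⟩ := h
    obtain ⟨w, hxw, hwv⟩ := ih hxv
    exact ⟨w, ⟨x, hux, hxw⟩, hwv⟩

theorem exists_stepRel_of_reflTransGen (Adj : V → V → Prop) {u v : V}
    (h : Relation.ReflTransGen Adj u v) : ∃ n, stepRel Adj n u v := by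
  induction h using Relation.ReflTransGen.head_induction_on with
  | refl => exact ⟨0, rfl⟩
  | head huw _ ih =>
    obtain ⟨n, hn⟩ := ih
    exact ⟨n + 1, _, huw, hn⟩

theorem stepRel_ddist (Adj : V → V → Prop) {u v : V}
    (h : Relation.ReflTransGen Adj u v) : stepRel Adj (ddist Adj u v) u v :=
  Nat.sInf_mem (exists_stepRel_of_reflTransGen Adj h)

theorem ddist_le_fdiam [Fintype V] (Adj : V → V → Prop) {u v : V}
    (h : Relation.ReflTransGen Adj u v) : ddist Adj u v ≤ fdiam Adj :=
  Finset.le_sup (f := fun p : V × V => ddist Adj p.1 p.2) (b := (u, v)) (by simpa using h)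

theorem flood_mono [Fintype V] [DecidableEq V] (Adj : V → V → Prop) (i : V) :
    Monotone (fun k => flood Adj k i) :=
  monotone_nat_of_le_succ fun _ => Finset.subset_union_left

theorem reflTransGen_of_mem_flood [Fintype V] [DecidableEq V] (Adj : V → V → Prop) {k : ℕ}
    {u v : V} (h : u ∈ flood Adj k v) : Relation.ReflTransGen Adj u v := by
  induction k generalizing v with
  | zero =>
    obtain rfl : u = v := by simpa [flood] using h
    exact .refl
  | succ k ih =>
    simp only [flood, Finset.mem_union, Finset.mem_biUnion, Finset.mem_filter,
      Finset.mem_univ, true_and] at h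
    obtain h | ⟨w, hwv, h⟩ := h
    · exact ih h
    · exact (ih h).tail hwv

theorem mem_flood_of_stepRel [Fintype V] [DecidableEq V] (Adj : V → V → Prop) {n : ℕ}
    {u v : V} (h : stepRel Adj n u v) : u ∈ flood Adj n v := by
  induction n generalizing v with
  | zero =>
    obtain rfl : u = v := h
    simp [flood]
  | succ n ih =>
    obtain ⟨w, huw, hwv⟩ := stepRel_succ_right Adj h
    simp only [flood, Finset.mem_union, Finset.mem_biUnion, Finset.mem_filter,
      Finset.mem_univ, true_and]
    exact .inr ⟨w, hwv, ih huw⟩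

theorem flood_eq_reachSet [Fintype V] [DecidableEq V] (Adj : V → V → Prop) {k : ℕ}
    (hk : fdiam Adj ≤ k) (v : V) : flood Adj k v = reachSet Adj v := by
  ext u
  simp only [reachSet, Finset.mem_filter, Finset.mem_univ, true_and]
  exact ⟨reflTransGen_of_mem_flood Adj, fun h =>
    flood_mono Adj v ((ddist_le_fdiam Adj h).trans hk)
      (mem_flood_of_stepRel Adj (stepRel_ddist Adj h))⟩

theorem reachSet_subset [Fintype V] (Adj : V → V → Prop) {u v : V}
    (h : Relation.ReflTransGen Adj u v) : reachSet Adj u ⊆ reachSet Adj v := by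
  intro w hw
  simp only [reachSet, Finset.mem_filter, Finset.mem_univ, true_and] at hw ⊢
  exact hw.trans h

/-- end-to-end correctness: for every `k ≥ D` and every vertex `i`,
`z_i = {j ∈ X k i : |X k j| = |X k i|}` equals the SCC of `i`. -/
theorem stmt14 [Fintype V] [DecidableEq V] (Adj : V → V → Prop) (k : ℕ)
    (hk : k ≥ fdiam Adj) (i : V) :
    (flood Adj k i).filter (fun j => (flood Adj k j).card = (flood Adj k i).card) =
    Finset.univ.filter
      (fun j => Relation.ReflTransGen Adj j i ∧ Relation.ReflTransGen Adj i j) := by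
  simp only [flood_eq_reachSet Adj hk]
  ext j
  have mem_reachSet (u v : V) : u ∈ reachSet Adj v ↔ Relation.ReflTransGen Adj u v := by
    simp [reachSet]
  simp only [Finset.mem_filter, Finset.mem_univ, true_and, mem_reachSet]
  refine and_congr_right fun hji => ⟨fun hcard => ?_, fun hij => ?_⟩
  · rw [← mem_reachSet, Finset.eq_of_subset_of_card_le (reachSet_subset Adj hji) hcard.ge,
      mem_reachSet]
  · rw [(reachSet_subset Adj hji).antisymm (reachSet_subset Adj hij)]
end
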